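/- arXiv:cs/0504085 — 7 statements merged into one kernel-verified Lean document; each statement's English description precedes it below -/
import Mathlib

section
/- Let a ≥ 1, b ≥ 0, c > 0 and P > 0, and define f(u) = log(a + b·u)/(c + u) for u ∈ [0, P]. Then for every u ∈ [0, P], f(u) ≥ min(f(0), f(P)); that is, the minimum of f over the interval [0, P] is attained at one of the two endpoints. -/
/-- For `a ≥ 1`, `b ≥ 0`, `c > 0`, `P > 0`, the function
`f(u) = log(a + b·u)/(c + u)` on `[0, P]` attains its minimum at an endpoint:
every value is at least `min (f 0) (f P)`. -/
theorem endpoint_min_of_log_ratio (a b c P : ℝ) (ha : 1 ≤ a) (hb : 0 ≤ b)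
    (hc : 0 < c) (hP : 0 < P) (f : ℝ → ℝ)
    (hf : ∀ u, f u = Real.log (a + b * u) / (c + u)) :
    ∀ u ∈ Set.Icc (0 : ℝ) P, min (f 0) (f P) ≤ f u := by
  rintro u ⟨hu0, huP⟩
  set m := min (f 0) (f P) with hm
  have h0 : m * c ≤ Real.log a := by
    have h : m ≤ f 0 := min_le_left _ _
    rw [hf, mul_zero, add_zero, add_zero] at h
    exact (le_div_iff₀ hc).mp h
  have h1 : m * (c + P) ≤ Real.log (a + b * P) := by
    have h : m ≤ f P := min_le_right _ _
    rw [hf] at h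
    exact (le_div_iff₀ (by positivity)).mp h
  have ht0 : 0 ≤ u / P := by positivity
  have ht1 : 0 ≤ 1 - u / P := sub_nonneg.mpr ((div_le_one hP).mpr huP)
  have ha0 : 0 < a := by linarith
  have haP : 0 < a + b * P := by positivity
  have concave := strictConcaveOn_log_Ioi.concaveOn.2 (Set.mem_Ioi.mpr ha0)
    (Set.mem_Ioi.mpr haP) ht1 ht0 (by ring)
  simp only [smul_eq_mul] at concave
  have harg : (1 - u / P) * a + u / P * (a + b * P) = a + b * u := by
    field_simp
    ring
  rw [harg] at concave
  rw [hf, le_div_iff₀ (by positivity)]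
  calc m * (c + u) = (1 - u / P) * (m * c) + u / P * (m * (c + P)) := by
        field_simp
        ring
    _ ≤ (1 - u / P) * Real.log a + u / P * Real.log (a + b * P) := by gcongr
    _ ≤ Real.log (a + b * u) := concave
end

section
/- The set function α is submodular: for all subsets A, B of the index set {1,…,n}, α(A ∪ B) + α(A ∩ B) ≤ α(A) + α(B). -/
namespace Matrix

open scoped ComplexOrder

variable {n 𝕜 : Type*} [Fintype n] [RCLike 𝕜]

open scoped MatrixOrder in
theorem PosSemidef.exists_eq_conjTranspose_mul_self {A : Matrix n n 𝕜} (hA : A.PosSemidef) :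
    ∃ C : Matrix n n 𝕜, A = Cᴴ * C := by
  classical
  exact CStarAlgebra.nonneg_iff_eq_star_mul_self.mp hA.nonneg

variable [DecidableEq n]

theorem PosSemidef.one_le_det_one_add {Q : Matrix n n 𝕜} (hQ : Q.PosSemidef) :
    1 ≤ (1 + Q).det := by
  rw [hQ.1.spectral_theorem, Unitary.conjStarAlgAut_apply, Matrix.mul_assoc,
    det_one_add_mul_comm, Matrix.mul_assoc, Unitary.coe_star_mul_self, Matrix.mul_one,
    ← diagonal_one, diagonal_add, det_diagonal]
  refine Finset.one_le_prod fun i _ => ?_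
  simpa using hQ.eigenvalues_nonneg i

theorem PosDef.det_le_det_add {A Q : Matrix n n 𝕜} (hA : A.PosDef) (hQ : Q.PosSemidef) :
    A.det ≤ (A + Q).det := by
  obtain ⟨C, rfl⟩ := hQ.exists_eq_conjTranspose_mul_self
  rw [det_add_mul _ _ hA.det_pos.ne'.isUnit]
  exact le_mul_of_one_le_right hA.det_pos.le
    (hA.inv.posSemidef.mul_mul_conjTranspose_same C).one_le_det_one_add

theorem PosDef.posSemidef_inv_sub_inv_add {X Z : Matrix n n 𝕜} (hX : X.PosDef)
    (hZ : Z.PosSemidef) : (X⁻¹ - (X + Z)⁻¹).PosSemidef := by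
  have hXZ := hX.add_posSemidef hZ
  have hX_unit : IsUnit X.det := hX.det_pos.ne'.isUnit
  have hXZ_unit : IsUnit (X + Z).det := hXZ.det_pos.ne'.isUnit
  have h_eq : X⁻¹ - (X + Z)⁻¹ = (X + Z)⁻¹ * (Z + Z * X⁻¹ * Z) * (X + Z)⁻¹ := by
    have h_mid : Z + Z * X⁻¹ * Z = (X + Z) * X⁻¹ * (X + Z) - (X + Z) := by
      simp only [Matrix.add_mul, Matrix.mul_add, mul_nonsing_inv _ hX_unit,
        nonsing_inv_mul_cancel_right _ _ hX_unit, Matrix.one_mul]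
      abel
    rw [h_mid, Matrix.mul_sub, Matrix.sub_mul, nonsing_inv_mul _ hXZ_unit, Matrix.one_mul,
      Matrix.mul_assoc (X + Z), nonsing_inv_mul_cancel_left _ _ hXZ_unit,
      mul_nonsing_inv_cancel_right _ _ hXZ_unit]
  have h_psd : (Z + Z * X⁻¹ * Z).PosSemidef := by
    have h := hX.inv.posSemidef.mul_mul_conjTranspose_same Z
    rw [hZ.1.eq] at h
    exact hZ.add h
  have h := h_psd.mul_mul_conjTranspose_same (X + Z)⁻¹
  rwa [hXZ.inv.1.eq, ← h_eq] at h

theorem PosDef.det_add_add_mul_det_le {X Y Z : Matrix n n 𝕜} (hX : X.PosDef)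
    (hY : Y.PosSemidef) (hZ : Z.PosSemidef) :
    (X + Y + Z).det * X.det ≤ (X + Y).det * (X + Z).det := by
  have hXZ := hX.add_posSemidef hZ
  obtain ⟨C, rfl⟩ := hY.exists_eq_conjTranspose_mul_self
  rw [add_right_comm, det_add_mul _ _ hXZ.det_pos.ne'.isUnit,
    det_add_mul _ _ hX.det_pos.ne'.isUnit]
  have h_posDef : (1 + C * (X + Z)⁻¹ * Cᴴ).PosDef :=
    PosDef.one.add_posSemidef (hXZ.inv.posSemidef.mul_mul_conjTranspose_same C)
  have h_le := h_posDef.det_le_det_add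
    ((hX.posSemidef_inv_sub_inv_add hZ).mul_mul_conjTranspose_same C)
  rw [Matrix.mul_sub, Matrix.sub_mul, add_assoc, add_sub_cancel] at h_le
  calc _ = X.det * (X + Z).det * (1 + C * (X + Z)⁻¹ * Cᴴ).det := by ring
    _ ≤ X.det * (X + Z).det * (1 + C * X⁻¹ * Cᴴ).det :=
      mul_le_mul_of_nonneg_left h_le (mul_nonneg hX.det_pos.le hXZ.det_pos.le)
    _ = _ := by ring

end Matrix

open Matrix ComplexOrder

/-- Submodularity of `α(A) = log det(I + P·D_A·Σ·D_A)` for a Hermitian positive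
semidefinite matrix `Σ` (here `S`) and `P ≥ 0`, where `D_A` is the diagonal 0-1
matrix of the subset `A` of the index set. -/
theorem alpha_submodular (n : ℕ) (S : Matrix (Fin n) (Fin n) ℂ)
    (hS : S.PosSemidef) (P : ℝ) (hP : 0 ≤ P)
    (D : Finset (Fin n) → Matrix (Fin n) (Fin n) ℂ)
    (hD : ∀ A, D A = Matrix.diagonal (fun i => if i ∈ A then (1 : ℂ) else 0))
    (α : Finset (Fin n) → ℝ)
    (hα : ∀ A, α A = Real.log ((1 + (P : ℂ) • (D A * S * D A)).det.re)) :
    ∀ A B : Finset (Fin n), α (A ∪ B) + α (A ∩ B) ≤ α A + α B := by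
  intro A B
  obtain ⟨R, hR⟩ := (hS.smul (Complex.zero_le_real.mpr hP)).exists_eq_conjTranspose_mul_self
  have hD_idem (A) : D A * D A = D A := by
    rw [hD, diagonal_mul_diagonal]
    congr 1
    ext i
    split_ifs <;> simp
  have hD_union {A B : Finset (Fin n)} (h : Disjoint A B) : D (A ∪ B) = D A + D B := by
    rw [hD, hD, hD, diagonal_add]
    congr 1
    ext i
    have h_notMem : i ∈ A → i ∉ B := fun hA => Finset.disjoint_left.mp h hA
    by_cases hA : i ∈ A <;> by_cases hB : i ∈ B <;> simp_all
  have hD_posSemidef (A) : (D A).PosSemidef := by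
    rw [hD]
    refine PosSemidef.diagonal fun i => ?_
    dsimp only [Pi.zero_apply]
    split_ifs <;> simp
  set Q : Finset (Fin n) → Matrix (Fin n) (Fin n) ℂ := fun A => R * D A * Rᴴ with hQ
  have hQ_posSemidef (A) : (Q A).PosSemidef := (hD_posSemidef A).mul_mul_conjTranspose_same R
  have hQ_union {A B : Finset (Fin n)} (h : Disjoint A B) : Q (A ∪ B) = Q A + Q B := by
    simp only [hQ, hD_union h, Matrix.mul_add, Matrix.add_mul]
  have h_det (A) : (1 + (P : ℂ) • (D A * S * D A)).det = (1 + Q A).det := by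
    rw [← Matrix.smul_mul, ← Matrix.mul_smul, hR, ← Matrix.mul_assoc, Matrix.mul_assoc _ R,
      det_one_add_mul_comm, Matrix.mul_assoc R, ← Matrix.mul_assoc (D A), hD_idem,
      ← Matrix.mul_assoc]
  have h_posDef (A) : (1 + Q A).PosDef := PosDef.one.add_posSemidef (hQ_posSemidef A)
  have h_pos (A) := Complex.pos_iff.mp (h_posDef A).det_pos
  have hQA : Q A = Q (A ∩ B) + Q (A \ B) := by
    rw [← hQ_union (Finset.disjoint_sdiff_inter A B).symm, Finset.union_comm,
      Finset.sdiff_union_inter]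
  have hQB : Q B = Q (A ∩ B) + Q (B \ A) := by
    rw [Finset.inter_comm, ← hQ_union (Finset.disjoint_sdiff_inter B A).symm, Finset.union_comm,
      Finset.sdiff_union_inter]
  have hQAB : Q (A ∪ B) = Q A + Q (B \ A) := by
    rw [← hQ_union Finset.disjoint_sdiff, Finset.union_sdiff_self_eq_union]
  have h_le := (h_posDef (A ∩ B)).det_add_add_mul_det_le
    (hQ_posSemidef (A \ B)) (hQ_posSemidef (B \ A))
  simp only [add_assoc] at h_le
  rw [← add_assoc (Q (A ∩ B)), ← hQA, ← hQAB, ← hQB] at h_le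
  have h_re := (Complex.le_def.mp h_le).1
  simp only [Complex.mul_re, ← (h_pos _).2, mul_zero, sub_zero] at h_re
  simp only [hα, h_det]
  rw [← Real.log_mul (h_pos _).1.ne' (h_pos _).1.ne',
    ← Real.log_mul (h_pos _).1.ne' (h_pos _).1.ne']
  exact Real.log_le_log (mul_pos (h_pos _).1 (h_pos _).1) h_re
end

section
/- Let A be a nonempty finite subset of ℤ such that β(A)/|A| ≤ β(C)/|C| for every nonempty subset C of A, and let B be a nonempty finite subset of ℤ with β(B)/|B| ≤ β(A)/|A|. Then for every integer k, writing A + k = {a + k : a ∈ A}, one has β((A + k) ∪ B)/|(A + k) ∪ B| ≤ β(A)/|A|. -/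
/-- Let `β` be a nonnegative, monotone, submodular, translation-invariant set
function on finite subsets of `ℤ` with `β ∅ = 0`. If `A` is a nonempty finite
set whose ratio `β(A)/|A|` is minimal among its nonempty subsets, and `B` is a
nonempty finite set that is at least as good as `A`
(`β(B)/|B| ≤ β(A)/|A|`), then for every integer `k`, the set `(A + k) ∪ B` is
also at least as good as `A`. -/
theorem better_union_translate
    (β : Finset ℤ → ℝ)
    (hempty : β ∅ = 0)
    (hmono : ∀ C D : Finset ℤ, C ⊆ D → β C ≤ β D)
    (hsub : ∀ C D : Finset ℤ, β (C ∪ D) + β (C ∩ D) ≤ β C + β D)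
    (htrans : ∀ (C : Finset ℤ) (k : ℤ), β (C.image (· + k)) = β C)
    (A B : Finset ℤ) (hA : A.Nonempty) (hB : B.Nonempty)
    (hAmin : ∀ C : Finset ℤ, C ⊆ A → C.Nonempty → β A / A.card ≤ β C / C.card)
    (hBA : β B / B.card ≤ β A / A.card) :
    ∀ k : ℤ,
      β ((A.image (· + k)) ∪ B) / ((A.image (· + k)) ∪ B).card ≤
        β A / A.card := by
  intro k
  set r := β A / A.card with hr
  set A' := A.image (· + k) with hA'
  have hAcard : (0 : ℝ) < A.card := by exact_mod_cast hA.card_pos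
  have hBcard : (0 : ℝ) < B.card := by exact_mod_cast hB.card_pos
  have card_translate (C : Finset ℤ) (j : ℤ) : (C.image (· + j)).card = C.card :=
    Finset.card_image_of_injective C (add_left_injective j)
  have hβA : β A = r * A.card := by rw [hr, div_mul_cancel₀ _ hAcard.ne']
  have hβB : β B ≤ r * B.card := (div_le_iff₀ hBcard).mp hBA
  have hinter : r * (A' ∩ B).card ≤ β (A' ∩ B) := by
    rcases (A' ∩ B).eq_empty_or_nonempty with h | h
    · simp [h, hempty]
    · have hsubset : (A' ∩ B).image (· + -k) ⊆ A := by
        intro x hx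
        obtain ⟨y, hy, rfl⟩ := Finset.mem_image.mp hx
        obtain ⟨a, ha, rfl⟩ := Finset.mem_image.mp (Finset.mem_inter.mp hy).1
        simpa using ha
      have hmin := hAmin _ hsubset (h.image _)
      rw [htrans, card_translate] at hmin
      exact (le_div_iff₀ (by exact_mod_cast h.card_pos)).mp hmin
  have hcard : ((A' ∪ B).card : ℝ) + (A' ∩ B).card = A.card + B.card := by
    rw [← card_translate A k]
    exact_mod_cast Finset.card_union_add_card_inter A' B
  have hunion : (0 : ℝ) < (A' ∪ B).card := by
    exact_mod_cast (hB.mono Finset.subset_union_right).card_pos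
  have hβA' : β A' = β A := htrans A k
  rw [div_le_iff₀ hunion]
  have hscaled := congrArg (r * ·) hcard
  simp only [mul_add] at hscaled
  linarith [hsub A' B]
end

section
/- The sequence β({1, 2, …, n})/n converges as n → ∞, and its limit equals the infimum, over all nonempty finite subsets A of ℤ, of β(A)/|A|. -/
open Filter

/-- If `L` bounds every increment of a submodular `β` along the intervals `{1,…,n}` from below,
then `|A| * L ≤ β A` for every `A ⊆ {1,…,n}`. -/
theorem card_mul_le_of_subset_Icc {β : Finset ℤ → ℝ} {L : ℝ} (hempty : β ∅ = 0)
    (hsub : ∀ C D : Finset ℤ, β (C ∪ D) + β (C ∩ D) ≤ β C + β D)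
    (hL : ∀ n : ℕ, L ≤ β (Finset.Icc 1 ((n + 1 : ℕ) : ℤ)) - β (Finset.Icc 1 (n : ℤ))) (n : ℕ) :
    ∀ A : Finset ℤ, A ⊆ Finset.Icc 1 (n : ℤ) → A.card * L ≤ β A := by
  induction n with
  | zero =>
    intro A hA
    obtain rfl : A = ∅ := by simpa using hA
    simp [hempty]
  | succ n ih =>
    intro A hA
    by_cases hn : ((n + 1 : ℕ) : ℤ) ∈ A
    · have hunion : A ∪ Finset.Icc 1 (n : ℤ) = Finset.Icc 1 ((n + 1 : ℕ) : ℤ) := by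
        ext x
        have := @hA x
        grind
      have hinter : A ∩ Finset.Icc 1 (n : ℤ) = A.erase ((n + 1 : ℕ) : ℤ) := by
        ext x
        have := @hA x
        grind
      have herase := ih (A.erase ((n + 1 : ℕ) : ℤ)) (hinter ▸ Finset.inter_subset_right)
      have hcard : (A.card : ℝ) = (A.erase ((n + 1 : ℕ) : ℤ)).card + 1 := by
        exact_mod_cast (Finset.card_erase_add_one hn).symm
      have hAI := hsub A (Finset.Icc 1 (n : ℤ))
      rw [hunion, hinter] at hAI
      rw [hcard]
      linarith [hL n]
    · refine ih A fun x hx => ?_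
      have := hA hx
      have : x ≠ ((n + 1 : ℕ) : ℤ) := fun h => hn (h ▸ hx)
      grind

/-- The increments of a translation-invariant submodular function along the intervals `{1,…,n}`
are nonincreasing. -/
theorem antitone_Icc_sub {β : Finset ℤ → ℝ}
    (hsub : ∀ C D : Finset ℤ, β (C ∪ D) + β (C ∩ D) ≤ β C + β D)
    (htrans : ∀ (C : Finset ℤ) (k : ℤ), β (C.image (· + k)) = β C) :
    Antitone fun n : ℕ =>
      β (Finset.Icc 1 ((n + 1 : ℕ) : ℤ)) - β (Finset.Icc 1 (n : ℤ)) := by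
  refine antitone_nat_of_succ_le fun n => ?_
  have hunion : Finset.Icc 1 ((n + 1 : ℕ) : ℤ) ∪ (Finset.Icc 1 ((n + 1 : ℕ) : ℤ)).image (· + 1) =
      Finset.Icc 1 ((n + 1 + 1 : ℕ) : ℤ) := by
    rw [Finset.image_add_right_Icc]
    ext x
    grind
  have hinter : Finset.Icc 1 ((n + 1 : ℕ) : ℤ) ∩ (Finset.Icc 1 ((n + 1 : ℕ) : ℤ)).image (· + 1) =
      (Finset.Icc 1 (n : ℤ)).image (· + 1) := by
    simp only [Finset.image_add_right_Icc]
    ext x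
    grind
  have h := hsub (Finset.Icc 1 ((n + 1 : ℕ) : ℤ)) ((Finset.Icc 1 ((n + 1 : ℕ) : ℤ)).image (· + 1))
  rw [hunion, hinter, htrans, htrans] at h
  linarith

/-- Every finite set of integers has a translate inside some `{1,…,n}`. -/
theorem exists_image_add_subset_Icc (A : Finset ℤ) :
    ∃ (k : ℤ) (n : ℕ), A.image (· + k) ⊆ Finset.Icc 1 (n : ℤ) := by
  obtain ⟨a, ha⟩ := A.bddBelow
  obtain ⟨b, hb⟩ := A.bddAbove
  refine ⟨1 - a, (b + 1 - a).toNat, fun x hx => ?_⟩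
  obtain ⟨y, hy, rfl⟩ := Finset.mem_image.1 hx
  have hay : a ≤ y := ha hy
  have hyb : y ≤ b := hb hy
  rw [Finset.mem_Icc]
  omega

/-- Let `β` be a nonnegative, monotone, submodular, translation-invariant set
function on finite subsets of `ℤ` with `β ∅ = 0`. Then `β({1,…,n})/n` converges
as `n → ∞`, and the limit is the infimum of `β(A)/|A|` over all nonempty
finite subsets `A` of `ℤ`. -/
theorem tendsto_beta_interval_div
    (β : Finset ℤ → ℝ)
    (hempty : β ∅ = 0)
    (hmono : ∀ C D : Finset ℤ, C ⊆ D → β C ≤ β D)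
    (hsub : ∀ C D : Finset ℤ, β (C ∪ D) + β (C ∩ D) ≤ β C + β D)
    (htrans : ∀ (C : Finset ℤ) (k : ℤ), β (C.image (· + k)) = β C) :
    Tendsto (fun n : ℕ => β (Finset.Icc (1 : ℤ) n) / n) atTop
      (nhds (sInf {x : ℝ | ∃ A : Finset ℤ, A.Nonempty ∧ x = β A / A.card})) := by
  set d : ℕ → ℝ := fun n => β (Finset.Icc 1 ((n + 1 : ℕ) : ℤ)) - β (Finset.Icc 1 (n : ℤ))
  have hd_nonneg (n : ℕ) : 0 ≤ d n :=
    sub_nonneg.2 <| hmono _ _ <| Finset.Icc_subset_Icc_right (by simp)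
  have hbdd : BddBelow (Set.range d) := ⟨0, Set.forall_mem_range.2 hd_nonneg⟩
  have hlim : Tendsto (fun n : ℕ => β (Finset.Icc (1 : ℤ) n) / n) atTop (nhds (⨅ n, d n)) := by
    refine (tendsto_atTop_ciInf (antitone_Icc_sub hsub htrans) hbdd).cesaro.congr fun n => ?_
    rw [Finset.sum_range_sub fun n : ℕ => β (Finset.Icc 1 (n : ℤ))]
    simp [hempty, div_eq_inv_mul]
  have hle (A : Finset ℤ) : A.card * (⨅ n, d n) ≤ β A := by
    obtain ⟨k, n, hA⟩ := exists_image_add_subset_Icc A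
    have h := card_mul_le_of_subset_Icc hempty hsub (ciInf_le hbdd) n _ hA
    rwa [htrans, Finset.card_image_of_injective _ (add_left_injective k)] at h
  convert hlim using 2
  have hlower : ⨅ n, d n ∈
      lowerBounds {x : ℝ | ∃ A : Finset ℤ, A.Nonempty ∧ x = β A / A.card} := by
    rintro _ ⟨A, hA, rfl⟩
    rw [le_div_iff₀ (by exact_mod_cast hA.card_pos), mul_comm]
    exact hle A
  refine le_antisymm (ge_of_tendsto hlim ?_) (le_csInf ⟨_, {0}, by simp, rfl⟩ hlower)
  filter_upwards [eventually_ge_atTop 1] with n hn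
  exact csInf_le ⟨_, hlower⟩
    ⟨Finset.Icc 1 (n : ℤ), Finset.nonempty_Icc.2 (by exact_mod_cast hn), by simp⟩
end

section
/- Let 0 ≤ ρ < 1 and P > 0. Set c = 1 + P + ρ²(1 − P) and let z₊ = (c + √(c² − 4ρ²))/2 be the larger root of the quadratic z² − c·z + ρ² = 0. Then (1/2π)·∫_{−π}^{π} log(1 + P·(1 − ρ²)/(1 − 2ρ·cos ω + ρ²)) dω = log z₊. -/
open Real

lemma one_sub_two_mul_cos_add_sq_pos {a : ℝ} (ha : |a| < 1) (ω : ℝ) :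
    0 < 1 - 2 * a * cos ω + a ^ 2 := by
  have hcos : |a * cos ω| ≤ |a| := by
    rw [abs_mul]
    exact mul_le_of_le_one_right (abs_nonneg a) (abs_cos_le_one ω)
  nlinarith [le_abs_self (a * cos ω), sq_abs a, pow_pos (sub_pos.2 ha) 2]

lemma continuous_log_one_sub_two_mul_cos_add_sq {a : ℝ} (ha : |a| < 1) :
    Continuous fun ω : ℝ => log (1 - 2 * a * cos ω + a ^ 2) :=
  Continuous.log (by fun_prop) fun ω => (one_sub_two_mul_cos_add_sq_pos ha ω).ne'

lemma norm_circleMap_sub_ofReal_sq (a ω : ℝ) :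
    ‖circleMap 0 1 ω - (a : ℂ)‖ ^ 2 = 1 - 2 * a * cos ω + a ^ 2 := by
  rw [Complex.sq_norm, Complex.normSq_apply]
  simp only [circleMap, Complex.sub_re, Complex.sub_im, Complex.ofReal_re, Complex.ofReal_im,
    zero_add, Complex.ofReal_one, one_mul, Complex.exp_ofReal_mul_I_re,
    Complex.exp_ofReal_mul_I_im]
  linear_combination sin_sq_add_cos_sq ω

/-- The Poisson-type logarithmic integral vanishes inside the unit disc. -/
lemma integral_log_one_sub_two_mul_cos_add_sq {a : ℝ} (ha : |a| < 1) :
    ∫ ω in (-π)..π, log (1 - 2 * a * cos ω + a ^ 2) = 0 := by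
  have h := circleAverage_log_norm_sub_const₀ (a := (a : ℂ)) (by simpa using ha)
  rw [circleAverage_def, smul_eq_mul, mul_eq_zero] at h
  have h0 : ∫ ω in (0)..(2 * π), log ‖circleMap 0 1 ω - (a : ℂ)‖ = 0 :=
    h.resolve_left (by positivity)
  have hper : Function.Periodic (fun ω : ℝ => log (1 - 2 * a * cos ω + a ^ 2)) (2 * π) :=
    fun ω => by simp only [cos_add_two_pi]
  have hshift := hper.intervalIntegral_add_eq (-π) 0
  rw [show -π + 2 * π = π by ring, zero_add] at hshift
  rw [hshift]
  simp_rw [← norm_circleMap_sub_ofReal_sq, log_pow]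
  rw [intervalIntegral.integral_const_mul, h0, mul_zero]

/-- For the Gauss–Markov spectral density
`S(ω) = (1 − ρ²)/(1 − 2ρ·cos ω + ρ²)` with `0 ≤ ρ < 1` and `P > 0`, the
integral `(1/2π)·∫_{−π}^{π} log(1 + P·S(ω)) dω` equals `log z₊`, where `z₊` is
the larger root of `z² − c·z + ρ² = 0` with `c = 1 + P + ρ²(1 − P)`. -/
theorem gauss_markov_log_integral (ρ P : ℝ) (hρ0 : 0 ≤ ρ) (hρ1 : ρ < 1)
    (hP : 0 < P) (c z : ℝ) (hc : c = 1 + P + ρ ^ 2 * (1 - P))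
    (hz : z = (c + Real.sqrt (c ^ 2 - 4 * ρ ^ 2)) / 2) :
    (1 / (2 * π)) *
        ∫ ω in (-π)..π,
          Real.log (1 + P * (1 - ρ ^ 2) / (1 - 2 * ρ * Real.cos ω + ρ ^ 2)) =
      Real.log z := by
  have hcρ : 2 * ρ < c := by
    have : 0 < P * (1 - ρ ^ 2) := mul_pos hP (by nlinarith)
    nlinarith [sq_nonneg (1 - ρ)]
  have hdisc : 0 ≤ c ^ 2 - 4 * ρ ^ 2 := by nlinarith
  have hzρ : ρ < z := by
    have := sqrt_nonneg (c ^ 2 - 4 * ρ ^ 2)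
    linarith
  have hz0 : 0 < z := hρ0.trans_lt hzρ
  have hroot : z ^ 2 - c * z + ρ ^ 2 = 0 := by
    rw [hz]
    linear_combination (1 / 4) * sq_sqrt hdisc
  have hρ : |ρ| < 1 := by rwa [abs_of_nonneg hρ0]
  have ha : |ρ / z| < 1 := by
    rw [abs_of_nonneg (by positivity)]
    exact (div_lt_one hz0).2 hzρ
  have hlog (ω : ℝ) : log (1 + P * (1 - ρ ^ 2) / (1 - 2 * ρ * cos ω + ρ ^ 2)) =
      log z + log (1 - 2 * (ρ / z) * cos ω + (ρ / z) ^ 2) -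
        log (1 - 2 * ρ * cos ω + ρ ^ 2) := by
    have hden := one_sub_two_mul_cos_add_sq_pos hρ ω
    have hnum := one_sub_two_mul_cos_add_sq_pos ha ω
    rw [← log_mul hz0.ne' hnum.ne', ← log_div (mul_pos hz0 hnum).ne' hden.ne']
    congr 1
    rw [eq_div_iff hden.ne', add_mul, div_mul_cancel₀ _ hden.ne']
    field_simp
    subst hc
    linear_combination -hroot
  have hi := (continuous_log_one_sub_two_mul_cos_add_sq ha).intervalIntegrable
    (μ := MeasureTheory.volume) (-π) π
  have hi' := (continuous_log_one_sub_two_mul_cos_add_sq hρ).intervalIntegrable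
    (μ := MeasureTheory.volume) (-π) π
  simp_rw [hlog]
  rw [intervalIntegral.integral_sub (intervalIntegrable_const.add hi) hi',
    intervalIntegral.integral_add intervalIntegrable_const hi,
    integral_log_one_sub_two_mul_cos_add_sq ha, integral_log_one_sub_two_mul_cos_add_sq hρ,
    intervalIntegral.integral_const, smul_eq_mul]
  field_simp
  ring
end

section
/- Let S : [−π, π] → ℝ be measurable and nonnegative with (1/2π)·∫_{−π}^{π} S(ω) dω = 1 and with S square integrable on [−π, π]. Then lim_{P → 0⁺} (1/P)·(1 − (1/P)·(1/2π)·∫_{−π}^{π} log(1 + P·S(ω)) dω) = (1/2)·(1/2π)·∫_{−π}^{π} S(ω)² dω. -/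
open Real MeasureTheory Filter Topology

/-- Second order Taylor expansion of `log` at `1`, along the ray of slope `s`. -/
theorem tendsto_sub_log_one_add_mul_div_sq (s : ℝ) :
    Tendsto (fun P : ℝ => (P * s - Real.log (1 + P * s)) / P ^ 2) (𝓝[>] 0)
      (𝓝 (s ^ 2 / 2)) := by
  rw [tendsto_iff_norm_sub_tendsto_zero]
  have hlim : Tendsto (fun P : ℝ => P * |s| ^ 3 / (1 - P * |s|)) (𝓝[>] 0) (𝓝 0) := by
    have hc : ContinuousAt (fun P : ℝ => P * |s| ^ 3 / (1 - P * |s|)) 0 :=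
      ContinuousAt.div (by fun_prop) (by fun_prop) (by simp)
    simpa using hc.tendsto.mono_left nhdsWithin_le_nhds
  have hsmall : ∀ᶠ P : ℝ in 𝓝[>] 0, P * |s| < 1 := by
    have hc : Tendsto (fun P : ℝ => P * |s|) (𝓝[>] 0) (𝓝 (0 * |s|)) :=
      ((continuous_id.mul continuous_const).tendsto 0).mono_left nhdsWithin_le_nhds
    exact hc.eventually_lt_const (by simp)
  refine squeeze_zero' (.of_forall fun _ => norm_nonneg _) ?_ hlim
  filter_upwards [hsmall, self_mem_nhdsWithin] with P hP hP0
  have hP0 : 0 < P := hP0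
  have habs : |-(P * s)| = P * |s| := by rw [abs_neg, abs_mul, abs_of_pos hP0]
  have h := Real.abs_log_sub_add_sum_range_le (x := -(P * s)) (by rwa [habs]) 2
  rw [habs] at h
  simp only [Finset.sum_range_succ, Finset.sum_range_zero] at h
  have heq : (P * s - Real.log (1 + P * s)) / P ^ 2 - s ^ 2 / 2 =
      -(-(P * s) + (P * s) ^ 2 / 2 + Real.log (1 + P * s)) / P ^ 2 := by
    field_simp
    ring
  rw [heq, Real.norm_eq_abs, abs_div, abs_neg, abs_of_pos (pow_pos hP0 2),
    div_le_iff₀ (pow_pos hP0 2)]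
  have hrhs : P * |s| ^ 3 / (1 - P * |s|) * P ^ 2 = (P * |s|) ^ (2 + 1) / (1 - P * |s|) := by
    ring
  rw [hrhs]
  refine le_trans (le_of_eq ?_) h
  congr 1
  norm_num

theorem abs_sub_log_one_add_le_sq {t : ℝ} (ht : 0 ≤ t) : |t - Real.log (1 + t)| ≤ t ^ 2 := by
  have hle : Real.log (1 + t) ≤ t := by
    linarith [Real.log_le_sub_one_of_pos (show 0 < 1 + t by linarith)]
  have hge := Real.le_log_one_add_of_nonneg ht
  have hfrac : t - t ^ 2 ≤ 2 * t / (t + 2) := by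
    rw [le_div_iff₀ (by linarith)]
    nlinarith [sq_nonneg t, pow_nonneg ht 3]
  rw [abs_of_nonneg (by linarith)]
  linarith

/-- For a measurable nonnegative spectral density `S` on `[−π, π]` with
`(1/2π)·∫_{−π}^{π} S = 1` and `S` square integrable, the capacity per unit
energy `C_p(P) = 1 − (1/P)·(1/2π)·∫ log(1 + P·S)` satisfies
`C_p(P)/P → (1/2)·(1/2π)·∫ S²` as `P → 0⁺`. -/
theorem capacity_asymptotic_low_peak (S : ℝ → ℝ) (hmeas : Measurable S)
    (hpos : ∀ ω ∈ Set.Icc (-π) π, 0 ≤ S ω)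
    (hint : (1 / (2 * π)) * ∫ ω in (-π)..π, S ω = 1)
    (hsq : IntervalIntegrable (fun ω => S ω ^ 2) volume (-π) π) :
    Tendsto
      (fun P : ℝ =>
        (1 / P) *
          (1 - (1 / P) *
            ((1 / (2 * π)) * ∫ ω in (-π)..π, Real.log (1 + P * S ω))))
      (nhdsWithin 0 (Set.Ioi 0))
      (nhds ((1 / 2) * ((1 / (2 * π)) * ∫ ω in (-π)..π, S ω ^ 2))) := by
  have hS : IntervalIntegrable S volume (-π) π := by
    by_contra h
    simp [intervalIntegral.integral_undef h] at hint
  have hmem : ∀ ω ∈ Set.uIoc (-π) π, 0 ≤ S ω := by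
    intro ω hω
    rw [Set.uIoc_of_le (by linarith [Real.pi_pos])] at hω
    exact hpos ω (Set.Ioc_subset_Icc_self hω)
  have hmeasF (P : ℝ) : Measurable fun ω => Real.log (1 + P * S ω) := by fun_prop
  have hlim : Tendsto
      (fun P : ℝ => ∫ ω in (-π)..π, (P * S ω - Real.log (1 + P * S ω)) / P ^ 2)
      (𝓝[>] 0) (𝓝 (∫ ω in (-π)..π, S ω ^ 2 / 2)) := by
    refine intervalIntegral.tendsto_integral_filter_of_dominated_convergence
      (fun ω => S ω ^ 2) (.of_forall fun P => ?_) ?_ hsq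
      (.of_forall fun ω _ => tendsto_sub_log_one_add_mul_div_sq (S ω))
    · exact (((hmeas.const_mul P).sub (hmeasF P)).div_const _).aestronglyMeasurable
    · filter_upwards [self_mem_nhdsWithin] with P hP
      have hP : 0 < P := hP
      refine .of_forall fun ω hω => ?_
      rw [Real.norm_eq_abs, abs_div, abs_of_pos (pow_pos hP 2), div_le_iff₀ (pow_pos hP 2)]
      have h := abs_sub_log_one_add_le_sq (mul_nonneg hP.le (hmem ω hω))
      rwa [mul_pow, mul_comm (P ^ 2)] at h
  have hval : (1 / 2) * ((1 / (2 * π)) * ∫ ω in (-π)..π, S ω ^ 2) =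
      (1 / (2 * π)) * ∫ ω in (-π)..π, S ω ^ 2 / 2 := by
    rw [intervalIntegral.integral_div]
    ring
  rw [hval]
  refine (hlim.const_mul (1 / (2 * π))).congr' ?_
  filter_upwards [self_mem_nhdsWithin] with P hP
  have hP : 0 < P := hP
  have hlog : IntervalIntegrable (fun ω => Real.log (1 + P * S ω)) volume (-π) π := by
    refine (hS.const_mul P).mono_fun (hmeasF P).aestronglyMeasurable ?_
    refine (ae_restrict_iff' measurableSet_uIoc).2 (.of_forall fun ω hω => ?_)
    have ht : 0 ≤ P * S ω := mul_nonneg hP.le (hmem ω hω)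
    beta_reduce
    rw [Real.norm_of_nonneg (Real.log_nonneg (by linarith)), Real.norm_of_nonneg ht]
    linarith [Real.log_le_sub_one_of_pos (show 0 < 1 + P * S ω by linarith)]
  have hI : ∫ ω in (-π)..π, S ω = 2 * π := by
    field_simp at hint
    exact hint
  rw [intervalIntegral.integral_div, intervalIntegral.integral_sub (hS.const_mul P) hlog,
    intervalIntegral.integral_const_mul, hI]
  field_simp
end

section
/- Let μ be a finite positive Borel measure on [−π, π), let R(k) = ∫_{[−π,π)} e^{ikω} dμ(ω) for k ∈ ℤ, and for each n ≥ 1 let Σ_n be the n×n Hermitian positive semidefinite Toeplitz matrix with entries (Σ_n)_{jk} = R(j − k). Let S be the Radon–Nikodym derivative of the absolutely continuous part of μ with respect to the normalized Lebesgue measure dω/(2π). Then for every P > 0, the determinant of I + P·Σ_n is a real number ≥ 1 and lim_{n→∞} (1/n)·log det(I + P·Σ_n) = (1/2π)·∫_{−π}^{π} log(1 + P·S(ω)) dω. -/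
open Real MeasureTheory Filter Topology Matrix

namespace SzegoLimit

open scoped ComplexConjugate

/-- The character `ω ↦ e^{ikω}`. -/
noncomputable def character (k : ℤ) (ω : ℝ) : ℂ := Complex.exp (Complex.I * k * ω)

lemma continuous_character (k : ℤ) : Continuous (character k) := by
  unfold character; fun_prop

lemma norm_character (k : ℤ) (ω : ℝ) : ‖character k ω‖ = 1 := by
  have : Complex.I * k * ω = ((k * ω : ℝ) : ℂ) * Complex.I := by push_cast; ring
  rw [character, this, Complex.norm_exp_ofReal_mul_I]

lemma conj_character (k : ℤ) (ω : ℝ) : conj (character k ω) = character (-k) ω := by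
  simp [character, ← Complex.exp_conj]

lemma character_add (j k : ℤ) (ω : ℝ) :
    character (j + k) ω = character j ω * character k ω := by
  simp only [character, ← Complex.exp_add]
  congr 1; push_cast; ring

lemma character_sub (j k : ℤ) (ω : ℝ) :
    character (j - k) ω = character j ω * conj (character k ω) := by
  rw [conj_character, ← character_add, sub_eq_add_neg]

lemma integrable_character (μ : Measure ℝ) [IsFiniteMeasure μ] (k : ℤ) :
    Integrable (character k) μ :=
  Integrable.of_bound (continuous_character k).aestronglyMeasurable 1
    (ae_of_all _ fun ω => (norm_character k ω).le)

/-- The vector `(1, e^{iω}, …, e^{i(n-1)ω})`. -/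
noncomputable def characterVec (n : ℕ) (ω : ℝ) : EuclideanSpace ℂ (Fin n) :=
  WithLp.toLp 2 fun j => character (j : ℤ) ω

lemma continuous_characterVec (n : ℕ) : Continuous (characterVec n) := by
  unfold characterVec
  have (j : Fin n) := continuous_character (j : ℤ)
  fun_prop

lemma norm_characterVec_sq (n : ℕ) (ω : ℝ) : ‖characterVec n ω‖ ^ 2 = n := by
  simp [EuclideanSpace.norm_sq_eq, characterVec, norm_character]

/-- The Toeplitz matrix of the Fourier coefficients of `μ`. -/
noncomputable def toeplitz (μ : Measure ℝ) (n : ℕ) : Matrix (Fin n) (Fin n) ℂ :=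
  Matrix.of fun j k => ∫ ω, character ((j : ℤ) - (k : ℤ)) ω ∂μ

lemma toeplitz_quadratic (μ : Measure ℝ) [IsFiniteMeasure μ] (n : ℕ)
    (v : EuclideanSpace ℂ (Fin n)) :
    star v.ofLp ⬝ᵥ toeplitz μ n *ᵥ v.ofLp =
      ((∫ ω, ‖inner ℂ v (characterVec n ω)‖ ^ 2 ∂μ : ℝ) : ℂ) := by
  have h (ω : ℝ) : ((‖inner ℂ v (characterVec n ω)‖ ^ 2 : ℝ) : ℂ) =
      ∑ j : Fin n, ∑ k : Fin n, conj (v j) * (character ((j : ℤ) - (k : ℤ)) ω * v k) := by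
    rw [Complex.ofReal_pow, ← Complex.mul_conj', EuclideanSpace.inner_eq_star_dotProduct]
    simp only [dotProduct, characterVec, map_sum, Finset.sum_mul_sum, character_sub, map_mul,
      Pi.star_apply, RCLike.star_def, Complex.conj_conj]
    refine Finset.sum_congr rfl fun j _ => Finset.sum_congr rfl fun k _ => ?_
    ring
  rw [← integral_complex_ofReal]
  simp_rw [h]
  have hi (j k : Fin n) :
      Integrable (fun ω => conj (v j) * (character ((j : ℤ) - (k : ℤ)) ω * v k)) μ :=
    ((integrable_character μ _).mul_const _).const_mul _
  rw [integral_finsetSum _ fun j _ => integrable_finsetSum _ fun k _ => hi j k]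
  simp only [dotProduct, mulVec, Finset.mul_sum]
  refine Finset.sum_congr rfl fun j _ => ?_
  rw [integral_finsetSum _ fun k _ => hi j k]
  refine Finset.sum_congr rfl fun k _ => ?_
  rw [integral_const_mul, integral_mul_const]
  rfl

lemma isHermitian_toeplitz (μ : Measure ℝ) (n : ℕ) : (toeplitz μ n).IsHermitian := by
  ext j k
  simp only [toeplitz, conjTranspose_apply, of_apply, RCLike.star_def, ← integral_conj,
    conj_character, neg_sub]

/-- The quadratic form of the Toeplitz matrix of `μ` at the vector of characters. -/
noncomputable def toeplitzForm (μ : Measure ℝ) (n : ℕ) (θ : ℝ) : ℝ :=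
  ∫ ω, ‖inner ℂ (characterVec n θ) (characterVec n ω)‖ ^ 2 ∂μ

lemma toeplitzForm_nonneg (μ : Measure ℝ) (n : ℕ) (θ : ℝ) : 0 ≤ toeplitzForm μ n θ :=
  integral_nonneg fun _ => by positivity

lemma toeplitzForm_eq_sum (μ : Measure ℝ) [IsFiniteMeasure μ] (n : ℕ) (θ : ℝ) :
    (toeplitzForm μ n θ : ℂ) = ∑ j : Fin n, ∑ k : Fin n,
      (∫ ω, character ((j : ℤ) - (k : ℤ)) ω ∂μ) * character ((k : ℤ) - (j : ℤ)) θ := by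
  rw [toeplitzForm, ← toeplitz_quadratic]
  simp only [dotProduct, mulVec, Finset.mul_sum, characterVec, character_sub (_ : ℤ) _ θ, toeplitz,
    of_apply, Pi.star_apply, RCLike.star_def]
  refine Finset.sum_congr rfl fun j _ => Finset.sum_congr rfl fun k _ => ?_
  ring

lemma continuous_toeplitzForm (μ : Measure ℝ) [IsFiniteMeasure μ] (n : ℕ) :
    Continuous (toeplitzForm μ n) := by
  have : toeplitzForm μ n = fun θ => (∑ j : Fin n, ∑ k : Fin n,
      (∫ ω, character ((j : ℤ) - (k : ℤ)) ω ∂μ) * character ((k : ℤ) - (j : ℤ)) θ).re := by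
    ext θ; rw [← toeplitzForm_eq_sum, Complex.ofReal_re]
  rw [this]
  refine Complex.continuous_re.comp <| continuous_finsetSum _ fun j _ =>
    continuous_finsetSum _ fun k _ => continuous_const.mul (continuous_character _)

lemma continuous_norm_inner_sq (n : ℕ) (v : EuclideanSpace ℂ (Fin n)) :
    Continuous fun ω => ‖inner ℂ v (characterVec n ω)‖ ^ 2 := by
  have := continuous_characterVec n
  fun_prop

lemma norm_inner_sq_le (n : ℕ) (v : EuclideanSpace ℂ (Fin n)) (ω : ℝ) :
    ‖inner ℂ v (characterVec n ω)‖ ^ 2 ≤ ‖v‖ ^ 2 * n := by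
  rw [← norm_characterVec_sq n ω, ← mul_pow]
  gcongr
  exact norm_inner_le_norm _ _

lemma integrable_norm_inner_sq (μ : Measure ℝ) [IsFiniteMeasure μ] (n : ℕ)
    (v : EuclideanSpace ℂ (Fin n)) :
    Integrable (fun ω => ‖inner ℂ v (characterVec n ω)‖ ^ 2) μ :=
  Integrable.of_bound (continuous_norm_inner_sq n v).aestronglyMeasurable (‖v‖ ^ 2 * n)
    (ae_of_all _ fun ω => by
      rw [Real.norm_of_nonneg (by positivity)]; exact norm_inner_sq_le n v ω)

section Eigenvalues

variable {μ : Measure ℝ} {n : ℕ} {P : ℝ}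

lemma isHermitian_one_add_smul_toeplitz (μ : Measure ℝ) (n : ℕ) (P : ℝ) :
    (1 + (P : ℂ) • toeplitz μ n).IsHermitian := by
  refine isHermitian_one.add ?_
  rw [IsHermitian, conjTranspose_smul, (isHermitian_toeplitz μ n).eq]
  simp

lemma eigenvalues_eq_integral [IsFiniteMeasure μ] (hA : (1 + (P : ℂ) • toeplitz μ n).IsHermitian)
    (i : Fin n) :
    hA.eigenvalues i =
      1 + P * ∫ ω, ‖inner ℂ (hA.eigenvectorBasis i) (characterVec n ω)‖ ^ 2 ∂μ := by
  rw [hA.eigenvalues_eq, add_mulVec, dotProduct_add, one_mulVec, smul_mulVec, dotProduct_smul,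
    toeplitz_quadratic, dotProduct_comm, ← EuclideanSpace.inner_eq_star_dotProduct,
    inner_self_eq_norm_sq_to_K, hA.eigenvectorBasis.norm_eq_one]
  norm_cast
  simp

lemma sum_eigenvalues_mul_norm_inner_sq [IsFiniteMeasure μ]
    (hA : (1 + (P : ℂ) • toeplitz μ n).IsHermitian) (θ : ℝ) :
    ∑ i, hA.eigenvalues i * ‖inner ℂ (hA.eigenvectorBasis i) (characterVec n θ)‖ ^ 2 =
      n + P * toeplitzForm μ n θ := by
  set e := characterVec n θ with he
  have h2 : star e.ofLp ⬝ᵥ (1 + (P : ℂ) • toeplitz μ n) *ᵥ e.ofLp =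
      ((n + P * toeplitzForm μ n θ : ℝ) : ℂ) := by
    rw [add_mulVec, dotProduct_add, one_mulVec, smul_mulVec, dotProduct_smul,
      toeplitz_quadratic, dotProduct_comm, ← EuclideanSpace.inner_eq_star_dotProduct,
      inner_self_eq_norm_sq_to_K, he]
    rw [← toeplitzForm, ← norm_characterVec_sq n θ]
    simp
  have h3 : star e.ofLp ⬝ᵥ (1 + (P : ℂ) • toeplitz μ n) *ᵥ e.ofLp =
      inner ℂ e (WithLp.toLp 2 ((1 + (P : ℂ) • toeplitz μ n) *ᵥ e.ofLp)) := by
    rw [EuclideanSpace.inner_eq_star_dotProduct, dotProduct_comm]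
  rw [h3, ← hA.eigenvectorBasis.sum_inner_mul_inner] at h2
  have h4 (i : Fin n) : inner ℂ (hA.eigenvectorBasis i)
      (WithLp.toLp 2 ((1 + (P : ℂ) • toeplitz μ n) *ᵥ e.ofLp)) =
      hA.eigenvalues i * inner ℂ (hA.eigenvectorBasis i) e := by
    have h5 : star (hA.eigenvectorBasis i).ofLp ᵥ* (1 + (P : ℂ) • toeplitz μ n) =
        star ((1 + (P : ℂ) • toeplitz μ n) *ᵥ (hA.eigenvectorBasis i).ofLp) := by
      rw [star_mulVec, hA.eq]
    rw [EuclideanSpace.inner_eq_star_dotProduct, EuclideanSpace.inner_eq_star_dotProduct,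
      dotProduct_comm, dotProduct_mulVec, h5,
      hA.mulVec_eigenvectorBasis, star_smul, smul_dotProduct, dotProduct_comm]
    simp
  simp_rw [h4] at h2
  apply Complex.ofReal_injective
  rw [← h2]
  push_cast
  refine Finset.sum_congr rfl fun i _ => ?_
  rw [← Complex.mul_conj', ← inner_conj_symm e]
  ring

end Eigenvalues

/-- Normalized Lebesgue measure `dω/(2π)` on `[-π, π)`. -/
noncomputable def circleMeasure : Measure ℝ :=
  ((ENNReal.ofReal (2 * π))⁻¹ • (volume : Measure ℝ)).restrict (Set.Ico (-π) π)

lemma integral_circleMeasure {E : Type*} [NormedAddCommGroup E] [NormedSpace ℝ E] (f : ℝ → E) :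
    ∫ ω, f ω ∂circleMeasure = (1 / (2 * π)) • ∫ ω in (-π)..π, f ω := by
  rw [circleMeasure, Measure.restrict_smul, integral_smul_measure,
    intervalIntegral.integral_of_le (by linarith [pi_pos]), integral_Ico_eq_integral_Ioc,
    ENNReal.toReal_inv, ENNReal.toReal_ofReal (by positivity), one_div]

instance : IsProbabilityMeasure circleMeasure := by
  constructor
  rw [circleMeasure, Measure.restrict_smul, Measure.smul_apply, Measure.restrict_apply_univ,
    Real.volume_Ico, smul_eq_mul, show π - -π = 2 * π by ring]
  exact ENNReal.inv_mul_cancel (by simp [pi_pos]) ENNReal.ofReal_ne_top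

lemma integral_character_circleMeasure (k : ℤ) :
    ∫ ω, character k ω ∂circleMeasure = if k = 0 then 1 else 0 := by
  split_ifs with hk
  · simp [character, hk]
  · have hc : Complex.I * k ≠ 0 := by simp [hk]
    rw [integral_circleMeasure]
    simp only [character]
    rw [integral_exp_mul_complex hc]
    have : Complex.exp (Complex.I * k * π) = Complex.exp (Complex.I * k * (-π : ℝ)) := by
      rw [Complex.exp_eq_exp_iff_exists_int]
      exact ⟨k, by push_cast; ring⟩
    rw [this]
    simp

lemma toeplitz_circleMeasure (n : ℕ) : toeplitz circleMeasure n = 1 := by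
  ext j k
  rw [toeplitz, of_apply, integral_character_circleMeasure, one_apply]
  simp [sub_eq_zero, Fin.ext_iff]

lemma integral_norm_inner_sq_circleMeasure {n : ℕ} (v : EuclideanSpace ℂ (Fin n)) :
    ∫ ω, ‖inner ℂ v (characterVec n ω)‖ ^ 2 ∂circleMeasure = ‖v‖ ^ 2 := by
  apply Complex.ofReal_injective
  rw [← toeplitz_quadratic, toeplitz_circleMeasure, one_mulVec, dotProduct_comm,
    ← EuclideanSpace.inner_eq_star_dotProduct, inner_self_eq_norm_sq_to_K]
  simp

lemma det_eq_ofReal_prod {μ : Measure ℝ} {n : ℕ} {P : ℝ}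
    (hA : (1 + (P : ℂ) • toeplitz μ n).IsHermitian) :
    (1 + (P : ℂ) • toeplitz μ n).det = ((∏ i, hA.eigenvalues i : ℝ) : ℂ) := by
  rw [hA.det_eq_prod_eigenvalues]
  simp

lemma log_le_log_add_div_sub_one {x y : ℝ} (hx : 0 < x) (hy : 0 < y) :
    log x ≤ log y + x / y - 1 := by
  have := log_le_sub_one_of_pos (div_pos hx hy)
  rw [log_div hx.ne' hy.ne'] at this
  linarith

section LogDet

variable {μ : Measure ℝ} [IsFiniteMeasure μ] {n : ℕ} {P : ℝ}

lemma one_le_eigenvalues (hP : 0 < P) (hA : (1 + (P : ℂ) • toeplitz μ n).IsHermitian)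
    (i : Fin n) : 1 ≤ hA.eigenvalues i := by
  rw [eigenvalues_eq_integral hA]
  have : 0 ≤ ∫ ω, ‖inner ℂ (hA.eigenvectorBasis i) (characterVec n ω)‖ ^ 2 ∂μ :=
    integral_nonneg fun _ => by positivity
  nlinarith

lemma log_det_eq_sum (hP : 0 < P) (hA : (1 + (P : ℂ) • toeplitz μ n).IsHermitian) :
    log (1 + (P : ℂ) • toeplitz μ n).det.re = ∑ i, log (hA.eigenvalues i) := by
  rw [det_eq_ofReal_prod hA, Complex.ofReal_re, log_prod]
  exact fun i _ => (zero_lt_one.trans_le (one_le_eigenvalues hP hA i)).ne'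

/-- Lower bound for the logarithm of the determinant in terms of a density `s` dominated
by `μ`. -/
lemma mul_integral_log_le_log_det (hP : 0 < P) {s : ℝ → ENNReal} (hs : Measurable s)
    (hs_lt : ∀ᵐ ω ∂circleMeasure, s ω < ⊤) (hsμ : circleMeasure.withDensity s ≤ μ) :
    n * ∫ ω, log (1 + P * (s ω).toReal) ∂circleMeasure ≤
      log (1 + (P : ℂ) • toeplitz μ n).det.re := by
  have hA := isHermitian_one_add_smul_toeplitz μ n P
  rw [log_det_eq_sum hP hA]
  set p : Fin n → ℝ → ℝ :=
    fun i ω => ‖inner ℂ (hA.eigenvectorBasis i) (characterVec n ω)‖ ^ 2 with hp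
  have hp_nonneg (i ω) : 0 ≤ p i ω := by positivity
  have hp_cont (i) : Continuous (p i) := continuous_norm_inner_sq n _
  have hp_le (i ω) : p i ω ≤ n := by
    simpa using norm_inner_sq_le n (hA.eigenvectorBasis i) ω
  have hp_int (i) : ∫ ω, p i ω ∂circleMeasure = 1 := by
    rw [hp, integral_norm_inner_sq_circleMeasure]; simp
  have hp_sum (ω) : ∑ i, p i ω = n := by
    rw [hp, hA.eigenvectorBasis.sum_sq_norm_inner_right, norm_characterVec_sq]
  have hs_int : Integrable (fun ω => (s ω).toReal) circleMeasure := by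
    refine integrable_toReal_of_lintegral_ne_top hs.aemeasurable ?_
    have := hsμ Set.univ
    rw [withDensity_apply _ .univ, Measure.restrict_univ] at this
    exact (this.trans_lt (measure_lt_top μ _)).ne
  have hbdd {f : ℝ → ℝ} (hf : Integrable f circleMeasure) (i : Fin n) :
      Integrable (fun ω => p i ω * f ω) circleMeasure :=
    hf.bdd_mul (hp_cont i).aestronglyMeasurable
      (ae_of_all _ fun ω => by rw [Real.norm_of_nonneg (hp_nonneg i ω)]; exact hp_le i ω)
  have hlog_int : Integrable (fun ω => log (1 + P * (s ω).toReal)) circleMeasure := by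
    refine (hs_int.const_mul P).mono'
      (measurable_log.comp (by fun_prop)).aestronglyMeasurable (ae_of_all _ fun ω => ?_)
    have h0 : 0 ≤ P * (s ω).toReal := by positivity
    rw [Real.norm_of_nonneg (log_nonneg (by linarith))]
    have := log_le_sub_one_of_pos (show 0 < 1 + P * (s ω).toReal by linarith)
    linarith
  have hint_p (i) : Integrable (p i) circleMeasure := integrable_norm_inner_sq _ n _
  have key (i : Fin n) :
      ∫ ω, p i ω * log (1 + P * (s ω).toReal) ∂circleMeasure ≤ log (hA.eigenvalues i) := by
    have hl : 0 < hA.eigenvalues i := zero_lt_one.trans_le (one_le_eigenvalues hP hA i)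
    set l := hA.eigenvalues i with hl_def
    have h1 : ∫ ω, p i ω * (s ω).toReal ∂circleMeasure ≤ ∫ ω, p i ω ∂μ := by
      calc _ = ∫ ω, p i ω ∂(circleMeasure.withDensity s) := by
            rw [integral_withDensity_eq_integral_toReal_smul hs hs_lt]
            simp_rw [smul_eq_mul, mul_comm]
        _ ≤ _ := integral_mono_measure hsμ (ae_of_all _ (hp_nonneg i))
            (integrable_norm_inner_sq _ n _)
    calc ∫ ω, p i ω * log (1 + P * (s ω).toReal) ∂circleMeasure
        ≤ ∫ ω, ((log l - 1 + l⁻¹) * p i ω + (P / l) * (p i ω * (s ω).toReal))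
            ∂circleMeasure := by
          refine integral_mono (hbdd hlog_int i)
            (((hint_p i).const_mul _).add ((hbdd hs_int i).const_mul _)) fun ω => ?_
          have h0 : 0 ≤ P * (s ω).toReal := by positivity
          have := mul_le_mul_of_nonneg_left
            (log_le_log_add_div_sub_one (show 0 < 1 + P * (s ω).toReal by linarith) hl)
            (hp_nonneg i ω)
          refine this.trans_eq ?_
          field_simp
          ring
      _ = (log l - 1 + l⁻¹) + (P / l) * ∫ ω, p i ω * (s ω).toReal ∂circleMeasure := by
          rw [integral_add ((hint_p i).const_mul _) ((hbdd hs_int i).const_mul _),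
            integral_const_mul, integral_const_mul, hp_int, mul_one]
      _ ≤ (log l - 1 + l⁻¹) + (P / l) * ∫ ω, p i ω ∂μ := by gcongr
      _ = log l := by
          have h2 : P * ∫ ω, p i ω ∂μ = l - 1 := by
            rw [hl_def, eigenvalues_eq_integral hA i]; ring
          rw [div_mul_eq_mul_div, h2]
          field_simp
          ring
  calc n * ∫ ω, log (1 + P * (s ω).toReal) ∂circleMeasure
      = ∑ i, ∫ ω, p i ω * log (1 + P * (s ω).toReal) ∂circleMeasure := by
        rw [← integral_finsetSum _ fun i _ => hbdd hlog_int i, ← integral_const_mul]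
        simp_rw [← Finset.sum_mul, hp_sum]
    _ ≤ _ := Finset.sum_le_sum fun i _ => key i

/-- Upper bound for the logarithm of the determinant in terms of a positive test function. -/
lemma log_det_le (hP : 0 < P) {g : ℝ → ℝ} (hg : Measurable g) {δ C : ℝ} (hδ : 0 < δ)
    (hδg : ∀ ω, δ ≤ g ω) (hgC : ∀ ω, g ω ≤ C) :
    log (1 + (P : ℂ) • toeplitz μ n).det.re ≤
      n * (-∫ ω, log (g ω) ∂circleMeasure) + n * (∫ ω, g ω ∂circleMeasure)
        + P * (∫ ω, g ω * toeplitzForm μ n ω ∂circleMeasure) - n := by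
  have hA := isHermitian_one_add_smul_toeplitz μ n P
  rw [log_det_eq_sum hP hA]
  set p : Fin n → ℝ → ℝ :=
    fun i ω => ‖inner ℂ (hA.eigenvectorBasis i) (characterVec n ω)‖ ^ 2 with hp
  have hp_nonneg (i ω) : 0 ≤ p i ω := by positivity
  have hp_int (i) : ∫ ω, p i ω ∂circleMeasure = 1 := by
    rw [hp, integral_norm_inner_sq_circleMeasure]; simp
  have hp_sum (ω) : ∑ i, p i ω = n := by
    rw [hp, hA.eigenvectorBasis.sum_sq_norm_inner_right, norm_characterVec_sq]
  have hint_p (i) : Integrable (p i) circleMeasure := integrable_norm_inner_sq _ n _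
  have hg_int : Integrable g circleMeasure :=
    Integrable.of_bound hg.aestronglyMeasurable C (ae_of_all _ fun ω => by
      rw [Real.norm_of_nonneg (hδ.le.trans (hδg ω))]; exact hgC ω)
  have hlog_int : Integrable (fun ω => log (g ω)) circleMeasure := by
    refine Integrable.of_bound (measurable_log.comp hg).aestronglyMeasurable
      (max |log δ| |log C|) (ae_of_all _ fun ω => ?_)
    exact abs_le_max_abs_abs (log_le_log hδ (hδg ω))
      (log_le_log (hδ.trans_le (hδg ω)) (hgC ω))
  have hform_int : Integrable (fun ω => g ω * toeplitzForm μ n ω) circleMeasure := by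
    have h1 : Integrable (toeplitzForm μ n) circleMeasure := by
      rw [circleMeasure, Measure.restrict_smul]
      refine Integrable.smul_measure ?_ (by simp [pi_pos])
      exact (continuous_toeplitzForm μ n).integrableOn_Icc.mono_set Set.Ico_subset_Icc_self
    exact h1.bdd_mul hg.aestronglyMeasurable (c := C) (ae_of_all _ fun ω => by
      rw [Real.norm_of_nonneg (hδ.le.trans (hδg ω))]; exact hgC ω)
  have i1 : Integrable (fun ω => n * (-log (g ω))) circleMeasure := hlog_int.neg.const_mul _
  have i2 : Integrable (fun ω => n * g ω) circleMeasure := hg_int.const_mul _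
  have i3 : Integrable (fun ω => P * (g ω * toeplitzForm μ n ω)) circleMeasure :=
    hform_int.const_mul _
  have i12 : Integrable (fun ω => n * (-log (g ω)) + n * g ω) circleMeasure := i1.add i2
  have i123 : Integrable
      (fun ω => n * (-log (g ω)) + n * g ω + P * (g ω * toeplitzForm μ n ω)) circleMeasure :=
    i12.add i3
  calc ∑ i, log (hA.eigenvalues i)
      = ∫ ω, ∑ i, p i ω * log (hA.eigenvalues i) ∂circleMeasure := by
        rw [integral_finsetSum _ fun i _ => (hint_p i).mul_const _]
        simp_rw [integral_mul_const, hp_int, one_mul]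
    _ ≤ ∫ ω, (n * (-log (g ω)) + n * g ω + P * (g ω * toeplitzForm μ n ω) - n)
          ∂circleMeasure := by
        refine integral_mono (integrable_finsetSum _ fun i _ => (hint_p i).mul_const _)
          (i123.sub (integrable_const _)) fun ω => ?_
        have hg0 : 0 < g ω := hδ.trans_le (hδg ω)
        calc ∑ i, p i ω * log (hA.eigenvalues i)
            ≤ ∑ i, (p i ω * (-log (g ω) - 1) + g ω * (hA.eigenvalues i * p i ω)) := by
              refine Finset.sum_le_sum fun i _ => ?_
              have hl : 0 < hA.eigenvalues i := zero_lt_one.trans_le (one_le_eigenvalues hP hA i)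
              have := mul_le_mul_of_nonneg_left
                (log_le_log_add_div_sub_one hl (inv_pos.mpr hg0)) (hp_nonneg i ω)
              rw [log_inv, div_inv_eq_mul] at this
              linarith
          _ = _ := by
              rw [Finset.sum_add_distrib, ← Finset.sum_mul, hp_sum, ← Finset.mul_sum,
                sum_eigenvalues_mul_norm_inner_sq hA]
              ring
    _ = _ := by
        rw [integral_sub i123 (integrable_const _), integral_add i12 i3,
          integral_add i1 i2, integral_const_mul, integral_const_mul, integral_const_mul,
          integral_neg]
        simp

end LogDet

lemma card_filter_sub_eq_le (n : ℕ) (l : ℤ) :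
    (Finset.univ.filter fun p : Fin n × Fin n => (p.1 : ℤ) - (p.2 : ℤ) = l).card ≤ n := by
  calc _ ≤ (Finset.univ : Finset (Fin n)).card := by
        refine Finset.card_le_card_of_injOn Prod.fst (fun _ _ => by simp) fun p hp q hq h => ?_
        simp only [Finset.coe_filter, Finset.mem_univ, true_and, Set.mem_ofPred_eq] at hp hq
        refine Prod.ext h (Fin.ext ?_)
        have := congrArg Fin.val h
        omega
    _ = n := by simp

lemma sub_natAbs_le_card_filter_sub_eq (n : ℕ) (l : ℤ) :
    n - l.natAbs ≤
      (Finset.univ.filter fun p : Fin n × Fin n => (p.1 : ℤ) - (p.2 : ℤ) = l).card := by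
  calc n - l.natAbs = (Finset.univ : Finset (Fin (n - l.natAbs))).card := by simp
    _ ≤ _ := by
        refine Finset.card_le_card_of_injOn
          (fun i => (⟨i + l.toNat, by omega⟩, ⟨i + (-l).toNat, by omega⟩)) (fun i _ => ?_)
          fun i _ j _ h => ?_
        · simp only [Finset.coe_filter, Finset.mem_univ, true_and, Set.mem_ofPred_eq]
          omega
        · simp only [Prod.mk.injEq, Fin.mk.injEq] at h
          exact Fin.ext (by omega)

lemma tendsto_card_filter_sub_eq_div (l : ℤ) :
    Tendsto (fun n : ℕ =>
      ((Finset.univ.filter fun p : Fin n × Fin n => (p.1 : ℤ) - (p.2 : ℤ) = l).card : ℝ) / n)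
      atTop (𝓝 1) := by
  have h : Tendsto (fun n : ℕ => 1 - (l.natAbs : ℝ) / n) atTop (𝓝 1) := by
    simpa using tendsto_const_nhds.sub (tendsto_const_div_atTop_nhds_zero_nat (l.natAbs : ℝ))
  refine tendsto_of_tendsto_of_tendsto_of_le_of_le' h tendsto_const_nhds ?_ ?_
  · filter_upwards [eventually_gt_atTop 0] with n hn
    have hn' : (0 : ℝ) < n := by exact_mod_cast hn
    rw [le_div_iff₀ hn', sub_mul, div_mul_cancel₀ _ hn'.ne', one_mul, sub_le_iff_le_add]
    have := sub_natAbs_le_card_filter_sub_eq n l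
    rw [tsub_le_iff_right] at this
    exact_mod_cast this
  · filter_upwards with n
    exact div_le_one_of_le₀ (by exact_mod_cast card_filter_sub_eq_le n l) (by positivity)

lemma integrable_circleMeasure_of_continuous {E : Type*} [NormedAddCommGroup E]
    [NormedSpace ℝ E] {f : ℝ → E} (hf : Continuous f) : Integrable f circleMeasure := by
  rw [circleMeasure, Measure.restrict_smul]
  refine Integrable.smul_measure ?_ (by simp [pi_pos])
  exact hf.integrableOn_Icc.mono_set Set.Ico_subset_Icc_self

instance : Fact (0 < 2 * π) := ⟨two_pi_pos⟩

lemma fourier_coe_eq_character (l : ℤ) (ω : ℝ) :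
    fourier l (ω : AddCircle (2 * π)) = character l ω := by
  rw [fourier_coe_apply, character]
  congr 1
  have : (π : ℂ) ≠ 0 := by exact_mod_cast pi_ne_zero
  push_cast
  field_simp

lemma continuous_comp_coe {E : Type*} [TopologicalSpace E] (G : C(AddCircle (2 * π), E)) :
    Continuous fun ω : ℝ => G ω :=
  G.continuous.comp (AddCircle.continuous_mk' _)

section WeakConvergence

variable (μ : Measure ℝ) [IsFiniteMeasure μ]

lemma integral_character_mul_toeplitzForm (n : ℕ) (l : ℤ) :
    ∫ θ, character l θ * (toeplitzForm μ n θ : ℂ) ∂circleMeasure =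
      (Finset.univ.filter fun p : Fin n × Fin n => (p.1 : ℤ) - (p.2 : ℤ) = l).card *
        ∫ ω, character l ω ∂μ := by
  have h (j k : Fin n) (θ : ℝ) : character l θ *
      ((∫ ω, character ((j : ℤ) - (k : ℤ)) ω ∂μ) * character ((k : ℤ) - (j : ℤ)) θ) =
      (∫ ω, character ((j : ℤ) - (k : ℤ)) ω ∂μ) * character (l + ((k : ℤ) - (j : ℤ))) θ := by
    rw [character_add]; ring
  simp_rw [toeplitzForm_eq_sum, Finset.mul_sum, h]
  have hi (j k : Fin n) : Integrable (fun θ => (∫ ω, character ((j : ℤ) - (k : ℤ)) ω ∂μ) *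
      character (l + ((k : ℤ) - (j : ℤ))) θ) circleMeasure :=
    (integrable_character _ _).const_mul _
  rw [integral_finsetSum _ fun j _ => integrable_finsetSum _ fun k _ => hi j k]
  simp_rw [integral_finsetSum _ fun k _ => hi _ k, integral_const_mul,
    integral_character_circleMeasure]
  rw [Finset.card_filter, Nat.cast_sum, Finset.sum_mul, Fintype.sum_prod_type]
  refine Finset.sum_congr rfl fun j _ => Finset.sum_congr rfl fun k _ => ?_
  by_cases hjk : (j : ℤ) - (k : ℤ) = l
  · rw [if_pos (by omega), if_pos hjk, hjk]; simp
  · rw [if_neg (by omega), if_neg hjk]; simp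

lemma integral_toeplitzForm_le (n : ℕ) :
    ∫ θ, toeplitzForm μ n θ ∂circleMeasure ≤ n * μ.real Set.univ := by
  have h := integral_character_mul_toeplitzForm μ n 0
  simp only [character, Int.cast_zero, mul_zero, zero_mul, Complex.exp_zero, one_mul,
    integral_complex_ofReal, integral_const, mul_one, Complex.real_smul] at h
  have h' : ∫ θ, toeplitzForm μ n θ ∂circleMeasure =
      ((Finset.univ.filter fun p : Fin n × Fin n => (p.1 : ℤ) - (p.2 : ℤ) = 0).card : ℝ) *
        μ.real Set.univ := by
    exact_mod_cast h
  rw [h']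
  gcongr
  exact card_filter_sub_eq_le n 0

lemma norm_integral_mul_toeplitzForm_div_le (G : C(AddCircle (2 * π), ℂ)) (n : ℕ) :
    ‖(∫ θ : ℝ, G θ * (toeplitzForm μ n θ : ℂ) ∂circleMeasure) / n‖ ≤
      ‖G‖ * μ.real Set.univ := by
  rw [norm_div, Complex.norm_natCast]
  refine div_le_of_le_mul₀ (by positivity) (by positivity) ?_
  calc ‖∫ θ : ℝ, G θ * (toeplitzForm μ n θ : ℂ) ∂circleMeasure‖
      ≤ ∫ θ, ‖G‖ * toeplitzForm μ n θ ∂circleMeasure := by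
        refine norm_integral_le_of_norm_le
          ((integrable_circleMeasure_of_continuous (continuous_toeplitzForm μ n)).const_mul _)
          (ae_of_all _ fun θ => ?_)
        rw [norm_mul, Complex.norm_real, Real.norm_of_nonneg (toeplitzForm_nonneg μ n θ)]
        exact mul_le_mul_of_nonneg_right (G.norm_coe_le_norm _) (toeplitzForm_nonneg μ n θ)
    _ ≤ ‖G‖ * (n * μ.real Set.univ) := by
        rw [integral_const_mul]
        exact mul_le_mul_of_nonneg_left (integral_toeplitzForm_le μ n) (norm_nonneg _)
    _ = _ := by ring

lemma norm_integral_comp_coe_le (G : C(AddCircle (2 * π), ℂ)) :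
    ‖∫ ω : ℝ, G ω ∂μ‖ ≤ ‖G‖ * μ.real Set.univ :=
  norm_integral_le_of_norm_le_const (ae_of_all _ fun _ => G.norm_coe_le_norm _)

lemma integrable_comp_coe {E : Type*} [NormedAddCommGroup E]
    (G : C(AddCircle (2 * π), E)) : Integrable (fun ω : ℝ => G ω) μ :=
  Integrable.of_bound (continuous_comp_coe G).aestronglyMeasurable ‖G‖
    (ae_of_all _ fun _ => G.norm_coe_le_norm _)

lemma integrable_mul_toeplitzForm (G : C(AddCircle (2 * π), ℂ)) (n : ℕ) :
    Integrable (fun θ : ℝ => G θ * (toeplitzForm μ n θ : ℂ)) circleMeasure :=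
  integrable_circleMeasure_of_continuous <| (continuous_comp_coe G).mul <|
    Complex.continuous_ofReal.comp (continuous_toeplitzForm μ n)

lemma tendsto_integral_mul_toeplitzForm_of_mem_span {G : C(AddCircle (2 * π), ℂ)}
    (hG : G ∈ Submodule.span ℂ (Set.range (@fourier (2 * π)))) :
    Tendsto (fun n : ℕ => (∫ θ : ℝ, G θ * (toeplitzForm μ n θ : ℂ) ∂circleMeasure) / n)
      atTop (𝓝 (∫ ω : ℝ, G ω ∂μ)) := by
  induction hG using Submodule.span_induction with
  | mem G hG =>
    obtain ⟨l, rfl⟩ := hG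
    simp_rw [fourier_coe_eq_character, integral_character_mul_toeplitzForm]
    have h := ((Complex.continuous_ofReal.tendsto _).comp
      (tendsto_card_filter_sub_eq_div l)).mul_const (∫ ω, character l ω ∂μ)
    simp only [Complex.ofReal_one, one_mul] at h
    refine h.congr fun n => ?_
    simp only [Function.comp_apply]
    push_cast
    ring
  | zero => simp
  | add F G _ _ hF hG =>
    have h1 : ∫ ω : ℝ, (F + G) ω ∂μ = ∫ ω : ℝ, F ω ∂μ + ∫ ω : ℝ, G ω ∂μ :=
      integral_add (integrable_comp_coe μ F) (integrable_comp_coe μ G)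
    rw [h1]
    refine (hF.add hG).congr fun n => ?_
    rw [← add_div, ← integral_add (integrable_mul_toeplitzForm μ F n)
      (integrable_mul_toeplitzForm μ G n)]
    simp [add_mul]
  | smul c G _ hG =>
    have h1 : ∫ ω : ℝ, (c • G) ω ∂μ = c * ∫ ω : ℝ, G ω ∂μ := integral_const_mul _ _
    rw [h1]
    refine (hG.const_mul c).congr fun n => ?_
    rw [← mul_div_assoc, ← integral_const_mul]
    simp [mul_assoc]

/-- The measures `(1/n) ⟨e_θ, Σ_n e_θ⟩ dθ/(2π)` converge weakly to `μ`. -/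
lemma tendsto_integral_mul_toeplitzForm (G : C(AddCircle (2 * π), ℂ)) :
    Tendsto (fun n : ℕ => (∫ θ : ℝ, G θ * (toeplitzForm μ n θ : ℂ) ∂circleMeasure) / n)
      atTop (𝓝 (∫ ω : ℝ, G ω ∂μ)) := by
  rw [Metric.tendsto_atTop]
  intro ε hε
  set M := μ.real Set.univ with hM
  have hM0 : 0 ≤ M := measureReal_nonneg
  have hG : G ∈ (Submodule.span ℂ (Set.range (@fourier (2 * π)))).topologicalClosure := by
    rw [span_fourier_closure_eq_top]; trivial
  obtain ⟨F, hF, hFG⟩ := Metric.mem_closure_iff.mp hG (ε / (3 * (M + 1))) (by positivity)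
  obtain ⟨N, hN⟩ := Metric.tendsto_atTop.mp
    (tendsto_integral_mul_toeplitzForm_of_mem_span μ hF) (ε / 3) (by positivity)
  have hsmall : ‖G - F‖ * M ≤ ε / 3 := by
    rw [dist_eq_norm] at hFG
    calc ‖G - F‖ * M ≤ ε / (3 * (M + 1)) * (M + 1) := by gcongr; linarith
      _ = ε / 3 := by field_simp
  refine ⟨N, fun n hn => ?_⟩
  have h1 := norm_integral_mul_toeplitzForm_div_le μ (G - F) n
  have h2 := norm_integral_comp_coe_le μ (G - F)
  have h3 := hN n hn
  have e1 : ∫ θ : ℝ, (G - F) θ * (toeplitzForm μ n θ : ℂ) ∂circleMeasure =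
      ∫ θ : ℝ, G θ * (toeplitzForm μ n θ : ℂ) ∂circleMeasure -
        ∫ θ : ℝ, F θ * (toeplitzForm μ n θ : ℂ) ∂circleMeasure := by
    rw [← integral_sub (integrable_mul_toeplitzForm μ G n) (integrable_mul_toeplitzForm μ F n)]
    simp [sub_mul]
  have e2 : ∫ ω : ℝ, (G - F) ω ∂μ = ∫ ω : ℝ, G ω ∂μ - ∫ ω : ℝ, F ω ∂μ :=
    integral_sub (integrable_comp_coe μ G) (integrable_comp_coe μ F)
  rw [e1, sub_div] at h1
  rw [e2] at h2
  rw [dist_eq_norm] at h3 ⊢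
  set a := (∫ θ : ℝ, G θ * (toeplitzForm μ n θ : ℂ) ∂circleMeasure) / n
  set b := (∫ θ : ℝ, F θ * (toeplitzForm μ n θ : ℂ) ∂circleMeasure) / n
  set c := ∫ ω : ℝ, G ω ∂μ
  set d := ∫ ω : ℝ, F ω ∂μ
  calc ‖a - c‖ = ‖(a - b) + (b - d) - (c - d)‖ := by congr 1; ring
    _ ≤ ‖a - b‖ + ‖b - d‖ + ‖c - d‖ := (norm_sub_le _ _).trans (by gcongr; exact norm_add_le _ _)
    _ < ε := by linarith

lemma tendsto_integral_mul_toeplitzForm_real (G : C(AddCircle (2 * π), ℝ)) :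
    Tendsto (fun n : ℕ => (∫ θ : ℝ, G θ * toeplitzForm μ n θ ∂circleMeasure) / n)
      atTop (𝓝 (∫ ω : ℝ, G ω ∂μ)) := by
  have h := (Complex.continuous_re.tendsto _).comp (tendsto_integral_mul_toeplitzForm μ
    ⟨fun x => (G x : ℂ), Complex.continuous_ofReal.comp G.continuous⟩)
  simp only [ContinuousMap.coe_mk, integral_complex_ofReal, Complex.ofReal_re] at h
  refine h.congr fun n => ?_
  simp only [Function.comp_apply, ← Complex.ofReal_mul, integral_complex_ofReal]
  rw [← Complex.ofReal_natCast, ← Complex.ofReal_div, Complex.ofReal_re]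

end WeakConvergence

/-- The density of the absolutely continuous part of `μ` with respect to `dω/(2π)`. -/
noncomputable def spectralDensity (μ : Measure ℝ) : ℝ → ENNReal :=
  μ.rnDeriv ((ENNReal.ofReal (2 * π))⁻¹ • (volume : Measure ℝ))

lemma measurable_spectralDensity (μ : Measure ℝ) : Measurable (spectralDensity μ) :=
  Measure.measurable_rnDeriv _ _

lemma sigmaFinite_smul_volume :
    SigmaFinite ((ENNReal.ofReal (2 * π))⁻¹ • (volume : Measure ℝ)) := by
  lift (ENNReal.ofReal (2 * π))⁻¹ to NNReal using by simp [pi_pos] with c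
  change SigmaFinite (c • (volume : Measure ℝ))
  exact SMul.sigmaFinite c

lemma spectralDensity_lt_top (μ : Measure ℝ) [IsFiniteMeasure μ] :
    ∀ᵐ ω ∂circleMeasure, spectralDensity μ ω < ⊤ := by
  have := sigmaFinite_smul_volume
  exact ae_restrict_of_ae (Measure.rnDeriv_lt_top _ _)

lemma withDensity_spectralDensity_le (μ : Measure ℝ) :
    circleMeasure.withDensity (spectralDensity μ) ≤ μ := by
  rw [circleMeasure, ← restrict_withDensity measurableSet_Ico]
  exact Measure.restrict_le_self.trans (Measure.withDensity_rnDeriv_le _ _)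

lemma integrable_spectralDensity (μ : Measure ℝ) [IsFiniteMeasure μ] :
    Integrable (fun ω => (spectralDensity μ ω).toReal) circleMeasure := by
  refine integrable_toReal_of_lintegral_ne_top (measurable_spectralDensity μ).aemeasurable ?_
  have := withDensity_spectralDensity_le μ Set.univ
  rw [withDensity_apply _ .univ, Measure.restrict_univ] at this
  exact (this.trans_lt (measure_lt_top μ _)).ne

section TestFunctions

variable {μ : Measure ℝ} [IsFiniteMeasure μ]

/-- A measurable function on `[-π, π)` is approximated in mean by continuous functions on the
circle. -/
lemma exists_continuousMap_integral_abs_sub_le (hsupp : μ (Set.Ico (-π) π)ᶜ = 0) {g : ℝ → ℝ}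
    (hg : Measurable g) (hg0 : ∀ ω, 0 ≤ g ω) (hg1 : ∀ ω, g ω ≤ 1) {η : ℝ} (hη : 0 < η) :
    ∃ G : C(AddCircle (2 * π), ℝ), ∫ ω : ℝ, |g ω - G ω| ∂μ ≤ η := by
  set φ : AddCircle (2 * π) → ℝ := fun x => (AddCircle.measurableEquivIco (2 * π) (-π) x : ℝ)
  have hφ : Measurable φ :=
    measurable_subtype_coe.comp (AddCircle.measurableEquivIco (2 * π) (-π)).measurable
  have hcoe : Measurable ((↑) : ℝ → AddCircle (2 * π)) := AddCircle.measurable_mk'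
  have hφcoe : ∀ ω ∈ Set.Ico (-π) π, φ (ω : AddCircle (2 * π)) = ω := by
    intro ω hω
    have hω' : ω ∈ Set.Ico (-π) (-π + 2 * π) := by
      rwa [show -π + 2 * π = π by ring]
    have := (AddCircle.measurableEquivIco (2 * π) (-π)).apply_symm_apply ⟨ω, hω'⟩
    exact congrArg Subtype.val this
  have hint : Integrable (g ∘ φ) (μ.map ((↑) : ℝ → AddCircle (2 * π))) :=
    Integrable.of_bound (hg.comp hφ).aestronglyMeasurable 1 (ae_of_all _ fun x => by
      rw [Function.comp_apply, Real.norm_of_nonneg (hg0 _)]; exact hg1 _)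
  obtain ⟨G, hG, -⟩ := hint.exists_boundedContinuous_integral_sub_le hη
  refine ⟨G.toContinuousMap, ?_⟩
  rw [integral_map hcoe.aemeasurable] at hG
  · refine (integral_congr_ae ?_).trans_le hG
    have hae : ∀ᵐ ω ∂μ, ω ∈ Set.Ico (-π) π := hsupp
    filter_upwards [hae] with ω hω
    simp [hφcoe ω hω, Real.norm_eq_abs]
  · exact ((hg.comp hφ).sub G.continuous.measurable).norm.aestronglyMeasurable

lemma circleMeasure_compl_Ico : circleMeasure (Set.Ico (-π) π)ᶜ = 0 := by
  rw [circleMeasure, Measure.restrict_apply measurableSet_Ico.compl]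
  simp

/-- A continuous function near `(1 + P S)⁻¹` in the mean, and small on the singular part of `μ`,
almost attains the infimum in the variational formula for `∫ log (1 + P S)`. -/
lemma exists_continuousMap_variational_le (hsupp : μ (Set.Ico (-π) π)ᶜ = 0) {P : ℝ}
    (hP : 0 < P) {ε : ℝ} (hε : 0 < ε) :
    ∃ G : C(AddCircle (2 * π), ℝ), (∃ δ > 0, ∀ x, δ ≤ G x) ∧
      -(∫ ω : ℝ, log (G ω) ∂circleMeasure) + ∫ ω : ℝ, G ω ∂circleMeasure
        + P * ∫ ω : ℝ, G ω ∂μ - 1 ≤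
      ∫ ω, log (1 + P * (spectralDensity μ ω).toReal) ∂circleMeasure + ε := by
  set s := spectralDensity μ with hs_def
  have hs : Measurable s := measurable_spectralDensity μ
  set ν := (ENNReal.ofReal (2 * π))⁻¹ • (volume : Measure ℝ) with hν
  have := sigmaFinite_smul_volume
  set N := (Measure.mutuallySingular_singularPart μ ν).nullSet with hN
  have hN_meas : MeasurableSet N := Measure.MutuallySingular.measurableSet_nullSet _
  have hNs : μ.singularPart ν N = 0 := Measure.MutuallySingular.measure_nullSet _
  have hNν : ν Nᶜ = 0 := Measure.MutuallySingular.measure_compl_nullSet _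
  have hNm : ∀ᵐ ω ∂circleMeasure, ω ∈ N := ae_restrict_of_ae hNν
  have hdecomp : μ = (μ.singularPart ν).restrict (Set.Ico (-π) π) +
      circleMeasure.withDensity s := by
    conv_lhs => rw [← Measure.restrict_eq_self_of_ae_mem (s := Set.Ico (-π) π) (μ := μ) hsupp,
      μ.haveLebesgueDecomposition_add ν, Measure.restrict_add,
      restrict_withDensity measurableSet_Ico]
    rfl
  set g : ℝ → ℝ := N.indicator fun ω => (1 + P * (s ω).toReal)⁻¹ with hg_def
  have hw (ω : ℝ) : 1 ≤ 1 + P * (s ω).toReal := by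
    have : 0 ≤ P * (s ω).toReal := by positivity
    linarith
  have hg : Measurable g := Measurable.indicator (by fun_prop) hN_meas
  have hg0 (ω : ℝ) : 0 ≤ g ω := Set.indicator_nonneg
    (fun ω _ => inv_nonneg.mpr (zero_le_one.trans (hw ω))) ω
  have hg1 (ω : ℝ) : g ω ≤ 1 :=
    Set.indicator_le' (fun ω _ => inv_le_one_of_one_le₀ (hw ω)) (fun _ _ => zero_le_one) ω
  have hgint (ρ : Measure ℝ) [IsFiniteMeasure ρ] : Integrable g ρ :=
    Integrable.of_bound hg.aestronglyMeasurable 1 (ae_of_all _ fun x => by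
      rw [Real.norm_of_nonneg (hg0 _)]; exact hg1 _)
  have hlog_int : Integrable (fun ω => log (1 + P * (s ω).toReal)) circleMeasure := by
    refine ((integrable_spectralDensity μ).const_mul P).mono'
      (measurable_log.comp (by fun_prop)).aestronglyMeasurable (ae_of_all _ fun ω => ?_)
    rw [Real.norm_of_nonneg (log_nonneg (hw ω))]
    have := log_le_sub_one_of_pos (zero_lt_one.trans_le (hw ω))
    linarith
  have hgμ : ∫ ω, g ω ∂circleMeasure + P * ∫ ω, g ω ∂μ = 1 := by
    have hwd : circleMeasure.withDensity s ≤ μ := withDensity_spectralDensity_le μ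
    have hfin : IsFiniteMeasure (circleMeasure.withDensity s) := isFiniteMeasure_of_le μ hwd
    have h0 : ∫ ω, g ω ∂((μ.singularPart ν).restrict (Set.Ico (-π) π)) = 0 := by
      refine integral_eq_zero_of_ae (ae_restrict_of_ae ?_)
      have : ∀ᵐ ω ∂(μ.singularPart ν), ω ∉ N := by
        rw [ae_iff]; simpa using hNs
      filter_upwards [this] with ω hω
      exact Set.indicator_of_notMem hω _
    have h1 : ∫ ω, g ω ∂μ = ∫ ω, (s ω).toReal * g ω ∂circleMeasure := by
      conv_lhs => rw [hdecomp]
      rw [integral_add_measure (hgint _) (hgint _), h0, zero_add,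
        integral_withDensity_eq_integral_toReal_smul hs (spectralDensity_lt_top μ)]
      rfl
    have h2 : Integrable (fun ω => (s ω).toReal * g ω) circleMeasure := by
      refine (integrable_spectralDensity μ).mul_bdd (c := 1) hg.aestronglyMeasurable
        (ae_of_all _ fun x => ?_)
      rw [Real.norm_of_nonneg (hg0 _)]
      exact hg1 _
    rw [h1, ← integral_const_mul, ← integral_add (hgint _) (h2.const_mul P)]
    have h3 : ∫ _ω : ℝ, (1 : ℝ) ∂circleMeasure = 1 := by simp
    rw [← h3]
    refine integral_congr_ae ?_
    filter_upwards [hNm] with ω hω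
    rw [hg_def, Set.indicator_of_mem hω]
    have := (zero_lt_one.trans_le (hw ω)).ne'
    field_simp
  set M := μ.real Set.univ with hM
  have hM0 : 0 ≤ M := measureReal_nonneg
  set δ := min 1 (ε / (3 + P + P * M)) with hδ_def
  have hδ : 0 < δ := lt_min one_pos (by positivity)
  have hδ1 : δ ≤ 1 := min_le_left _ _
  have hδε : δ * (3 + P + P * M) ≤ ε := (le_div_iff₀ (by positivity)).mp (min_le_right _ _)
  obtain ⟨G, hG⟩ := exists_continuousMap_integral_abs_sub_le (μ := circleMeasure + μ)
    (by simp [hsupp, circleMeasure_compl_Ico]) hg hg0 hg1 (show 0 < δ ^ 2 by positivity)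
  set d : ℝ → ℝ := fun ω => |g ω - G ω| with hd
  have hd_int (ρ : Measure ℝ) [IsFiniteMeasure ρ] : Integrable d ρ :=
    ((hgint ρ).sub (integrable_comp_coe ρ G)).abs
  rw [integral_add_measure (hd_int _) (hd_int _)] at hG
  have ha : 0 ≤ ∫ ω, d ω ∂circleMeasure := integral_nonneg fun _ => abs_nonneg _
  have hb : 0 ≤ ∫ ω, d ω ∂μ := integral_nonneg fun _ => abs_nonneg _
  set a := ∫ ω, d ω ∂circleMeasure with ha_def
  set b := ∫ ω, d ω ∂μ with hb_def
  set H : C(AddCircle (2 * π), ℝ) := G ⊔ ContinuousMap.const _ δ with hH_def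
  have hH (ω : ℝ) : H ω = max (G ω) δ := rfl
  have hHδ (x) : δ ≤ H x := le_max_right _ _
  have hHle (ω : ℝ) : H ω ≤ g ω + δ + d ω := by
    rw [hH]
    have := neg_abs_le (g ω - G ω)
    have := abs_nonneg (g ω - G ω)
    have := hg0 ω
    exact max_le (by simp only [hd]; linarith) (by simp only [hd]; linarith)
  have hH_int (ρ : Measure ℝ) [IsFiniteMeasure ρ] :
      ∫ ω : ℝ, H ω ∂ρ ≤ ∫ ω, g ω ∂ρ + δ * ρ.real Set.univ + ∫ ω, d ω ∂ρ := by
    have i1 : Integrable (fun ω => g ω + δ) ρ := (hgint ρ).add (integrable_const δ)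
    refine (integral_mono (integrable_comp_coe ρ H) (i1.add (hd_int ρ)) hHle).trans_eq ?_
    simp only [Pi.add_apply]
    rw [integral_add i1 (hd_int ρ), integral_add (hgint ρ) (integrable_const δ), integral_const,
      smul_eq_mul, mul_comm δ]
  have hH_log : -(∫ ω : ℝ, log (H ω) ∂circleMeasure) ≤
      ∫ ω, log (1 + P * (s ω).toReal) ∂circleMeasure + a / δ := by
    have hlogH : Continuous fun ω : ℝ => log (H ω) :=
      (continuous_comp_coe H).log fun ω => (hδ.trans_le (hHδ _)).ne'
    rw [← integral_neg, ha_def, ← integral_div, ← integral_add hlog_int ((hd_int _).div_const δ)]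
    refine integral_mono_ae (integrable_circleMeasure_of_continuous hlogH).neg
      (hlog_int.add ((hd_int _).div_const δ)) ?_
    filter_upwards [hNm] with ω hω
    have hHpos : 0 < H ω := hδ.trans_le (hHδ _)
    have hgω : g ω = (1 + P * (s ω).toReal)⁻¹ := Set.indicator_of_mem hω _
    have hgpos : 0 < g ω := by rw [hgω]; exact inv_pos.mpr (zero_lt_one.trans_le (hw ω))
    have h1 := log_le_log_add_div_sub_one hgpos hHpos
    have h2 : g ω / H ω - 1 ≤ d ω / δ := by
      rw [div_sub_one hHpos.ne']
      have h3 : g ω - H ω ≤ d ω := by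
        have := le_abs_self (g ω - G ω)
        have := le_max_left (G ω) δ
        rw [hH]; simp only [hd]; linarith
      exact div_le_div₀ (abs_nonneg _) h3 hδ (hHδ _)
    rw [hgω, log_inv] at h1
    rw [hgω] at h2
    linarith
  refine ⟨H, ⟨δ, hδ, hHδ⟩, ?_⟩
  have k1 := hH_int circleMeasure
  have k2 := mul_le_mul_of_nonneg_left (hH_int μ) hP.le
  have k3 : a / δ ≤ δ := by
    rw [div_le_iff₀ hδ]; nlinarith
  have k4 : P * b ≤ P * δ := by
    gcongr; nlinarith
  have k5 : a ≤ δ := by nlinarith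
  rw [probReal_univ, mul_one] at k1
  nlinarith

end TestFunctions

end SzegoLimit

/-- Szegő-type first limit theorem. Let `μ` be a finite positive Borel measure
on `[−π, π)`, `R k = ∫ e^{ikω} dμ(ω)` its Fourier coefficients, and `Σ_n`
(here `T n`) the `n×n` Toeplitz matrix with entries `R(j−k)`. Let `S` be the
Radon–Nikodym derivative of (the absolutely continuous part of) `μ` with
respect to the normalized Lebesgue measure `dω/(2π)`. Then for `P > 0`, the
determinant of `I + P·Σ_n` is a real number `≥ 1`, and
`(1/n)·log det(I + P·Σ_n) → (1/2π)·∫_{−π}^{π} log(1 + P·S(ω)) dω`. -/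
theorem szego_limit_log_det (μ : Measure ℝ) [IsFiniteMeasure μ]
    (hsupp : μ (Set.Ico (-π) π)ᶜ = 0)
    (R : ℤ → ℂ)
    (hR : ∀ k : ℤ, R k = ∫ ω, Complex.exp (Complex.I * k * ω) ∂μ)
    (T : (n : ℕ) → Matrix (Fin n) (Fin n) ℂ)
    (hT : ∀ (n : ℕ) (j k : Fin n), T n j k = R ((j : ℤ) - (k : ℤ)))
    (S : ℝ → ℝ)
    (hS : ∀ ω, S ω =
      (μ.rnDeriv ((ENNReal.ofReal (2 * π))⁻¹ • (volume : Measure ℝ)) ω).toReal)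
    (P : ℝ) (hP : 0 < P) :
    (∀ n : ℕ, (1 + (P : ℂ) • T n).det.im = 0 ∧ 1 ≤ (1 + (P : ℂ) • T n).det.re) ∧
    Tendsto
      (fun n : ℕ => (1 / (n : ℝ)) * Real.log ((1 + (P : ℂ) • T n).det.re))
      atTop
      (nhds ((1 / (2 * π)) * ∫ ω in (-π)..π, Real.log (1 + P * S ω))) := by
  have hTt : T = SzegoLimit.toeplitz μ := by
    ext n j k
    rw [hT, hR]
    simp [SzegoLimit.toeplitz, SzegoLimit.character]
  have hSs (ω : ℝ) : S ω = (SzegoLimit.spectralDensity μ ω).toReal := hS ω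
  subst hTt
  refine ⟨fun n => ?_, ?_⟩
  · have hA := SzegoLimit.isHermitian_one_add_smul_toeplitz μ n P
    rw [SzegoLimit.det_eq_ofReal_prod hA, Complex.ofReal_im, Complex.ofReal_re]
    exact ⟨rfl, Finset.one_le_prod fun i _ => SzegoLimit.one_le_eigenvalues hP hA i⟩
  simp_rw [hSs]
  rw [← smul_eq_mul (1 / (2 * π)), ← SzegoLimit.integral_circleMeasure]
  refine tendsto_order.mpr ⟨fun c hc => ?_, fun c hc => ?_⟩
  · filter_upwards [eventually_gt_atTop 0] with n hn
    have hn' : (0 : ℝ) < n := by exact_mod_cast hn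
    have h := SzegoLimit.mul_integral_log_le_log_det (n := n) hP
      (SzegoLimit.measurable_spectralDensity μ) (SzegoLimit.spectralDensity_lt_top μ)
      (SzegoLimit.withDensity_spectralDensity_le μ)
    rw [one_div_mul_eq_div]
    exact hc.trans_le ((le_div_iff₀' hn').mpr h)
  · obtain ⟨G, ⟨δ, hδ, hδG⟩, hG⟩ :=
      SzegoLimit.exists_continuousMap_variational_le hsupp hP (half_pos (sub_pos.mpr hc))
    have hstrict : -(∫ ω : ℝ, log (G ω) ∂SzegoLimit.circleMeasure)
        + ∫ ω : ℝ, G ω ∂SzegoLimit.circleMeasure - 1 + P * ∫ ω : ℝ, G ω ∂μ < c := by linarith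
    have hlim := ((SzegoLimit.tendsto_integral_mul_toeplitzForm_real μ G).const_mul P).const_add
      (-(∫ ω : ℝ, log (G ω) ∂SzegoLimit.circleMeasure)
        + ∫ ω : ℝ, G ω ∂SzegoLimit.circleMeasure - 1)
    filter_upwards [eventually_gt_atTop 0, hlim.eventually_lt_const hstrict]
      with n hn hlt
    have hn' : (0 : ℝ) < n := by exact_mod_cast hn
    have h := SzegoLimit.log_det_le (μ := μ) (n := n) hP
      (SzegoLimit.continuous_comp_coe G).measurable hδ (fun ω => hδG _)
      (fun ω => (le_abs_self _).trans (G.norm_coe_le_norm (ω : AddCircle (2 * π))))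
    refine lt_of_le_of_lt ?_ hlt
    rw [one_div_mul_eq_div, div_le_iff₀' hn']
    refine h.trans_eq ?_
    field_simp
    ring
end
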